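/- Coordinate iterated integrals, as real-valued functions on the set of C¹ paths γ : [a,b] → ℝ^d, span a linear space that contains the constant functions and is closed under pointwise multiplication: the constant function 1 equals γ ↦ S^∅_{a,b}(γ), and for any two words u, v over {1,…,d}, the pointwise product (γ ↦ S^u_{a,b}(γ)) · (γ ↦ S^v_{a,b}(γ)) is a finite linear combination (with natural number coefficients) of functions γ ↦ S^w_{a,b}(γ) for words w of length |u|+|v|. Hence the linear span of the coordinate iterated integrals is an algebra of functions on paths containing the constants. -/

import Mathlib

open MeasureTheory intervalIntegral Set Filter

/-- Signature coefficients of a path, indexed by words over `Fin d`. -/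
noncomputable def sig {d : ℕ} (γ : ℝ → EuclideanSpace ℝ (Fin d)) :
    List (Fin d) → ℝ → ℝ → ℝ
  | [], _, _ => 1
  | i :: w, s, t => ∫ u in s..t, deriv γ u i * sig γ w u t

/-- All shuffles (interleavings) of two words, listed with multiplicity. -/
def wordShuffle {α : Type*} : List α → List α → List (List α)
  | [], v => [v]
  | i :: u, [] => [i :: u]
  | i :: u, j :: v =>
      (wordShuffle u (j :: v)).map (List.cons i) ++ (wordShuffle (i :: u) v).map (List.cons j)
  termination_by u v => u.length + v.length

theorem length_of_mem_wordShuffle {α : Type*} (u v w : List α) (hw : w ∈ wordShuffle u v) :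
    w.length = u.length + v.length := by
  fun_induction wordShuffle u v generalizing w with
  | case1 v => simp_all
  | case2 i u => simp_all
  | case3 i u j v ih₁ ih₂ =>
    simp only [List.mem_append, List.mem_map] at hw
    rcases hw with ⟨x, hx, rfl⟩ | ⟨x, hx, rfl⟩
    · have := ih₁ x hx
      simp only [List.length_cons] at this ⊢
      omega
    · have := ih₂ x hx
      simp only [List.length_cons] at this ⊢
      omega

section Sig

variable {d : ℕ} {γ : ℝ → EuclideanSpace ℝ (Fin d)}

theorem continuous_deriv_apply (hγ : ContDiff ℝ 1 γ) (i : Fin d) :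
    Continuous fun s => deriv γ s i := by
  have h := hγ.continuous_deriv le_rfl
  fun_prop

theorem hasDerivAt_sig_cons_of_continuous (hγ : ContDiff ℝ 1 γ) (i : Fin d) (w : List (Fin d))
    (t : ℝ) (hw : Continuous fun s => sig γ w s t) (s : ℝ) :
    HasDerivAt (fun s => sig γ (i :: w) s t) (-(deriv γ s i * sig γ w s t)) s := by
  have hc : Continuous fun s => deriv γ s i * sig γ w s t :=
    (continuous_deriv_apply hγ i).mul hw
  simp only [sig]
  exact integral_hasDerivAt_left (hc.intervalIntegrable s t)
    (hc.stronglyMeasurableAtFilter _ _) hc.continuousAt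

theorem continuous_sig (hγ : ContDiff ℝ 1 γ) (w : List (Fin d)) (t : ℝ) :
    Continuous fun s => sig γ w s t := by
  induction w with
  | nil => simpa only [sig] using continuous_const
  | cons i w ih =>
    exact continuous_iff_continuousAt.2 fun s =>
      (hasDerivAt_sig_cons_of_continuous hγ i w t ih s).continuousAt

theorem hasDerivAt_sig_cons (hγ : ContDiff ℝ 1 γ) (i : Fin d) (w : List (Fin d)) (s t : ℝ) :
    HasDerivAt (fun s => sig γ (i :: w) s t) (-(deriv γ s i * sig γ w s t)) s :=
  hasDerivAt_sig_cons_of_continuous hγ i w t (continuous_sig hγ w t) s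

theorem sig_cons_self (i : Fin d) (w : List (Fin d)) (t : ℝ) : sig γ (i :: w) t t = 0 := by
  simp [sig]

theorem hasDerivAt_sum_sig_map_cons (hγ : ContDiff ℝ 1 γ) (i : Fin d) (l : List (List (Fin d)))
    (s t : ℝ) :
    HasDerivAt (fun s => ((l.map (List.cons i)).map fun w => sig γ w s t).sum)
      (-(deriv γ s i * (l.map fun w => sig γ w s t).sum)) s := by
  induction l with
  | nil => simpa using hasDerivAt_const s (0 : ℝ)
  | cons w l ih =>
    simp only [List.map_cons, List.sum_cons]
    exact ((hasDerivAt_sig_cons hγ i w s t).add ih).congr_deriv (by ring)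

theorem sum_sig_map_cons_self (i : Fin d) (l : List (List (Fin d))) (t : ℝ) :
    ((l.map (List.cons i)).map fun w => sig γ w t t).sum = 0 := by
  induction l with
  | nil => simp
  | cons w l ih =>
    simp only [List.map_cons, List.sum_cons, sig_cons_self, zero_add]
    exact ih

/-- The shuffle identity for signature coefficients. -/
theorem sig_mul_sig (hγ : ContDiff ℝ 1 γ) (u v : List (Fin d)) (s t : ℝ) :
    sig γ u s t * sig γ v s t = ((wordShuffle u v).map fun w => sig γ w s t).sum := by
  fun_induction wordShuffle u v generalizing s with
  | case1 v => simp [sig]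
  | case2 i u => simp [sig]
  | case3 i u j v ih₁ ih₂ =>
    rw [List.map_append, List.sum_append]
    have hderiv (x : ℝ) := ((hasDerivAt_sig_cons hγ i u x t).mul
      (hasDerivAt_sig_cons hγ j v x t)).sub
      ((hasDerivAt_sum_sig_map_cons hγ i (wordShuffle u (j :: v)) x t).add
        (hasDerivAt_sum_sig_map_cons hγ j (wordShuffle (i :: u) v) x t))
    have hconst := is_const_of_deriv_eq_zero (fun x => (hderiv x).differentiableAt)
      (fun x => by
        rw [(hderiv x).deriv, ← ih₁, ← ih₂]
        ring) s t
    simp only [Pi.sub_apply, Pi.mul_apply, Pi.add_apply, sig_cons_self,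
      sum_sig_map_cons_self] at hconst
    linarith

end Sig

/-- Coordinate iterated integrals, as functions on C¹ paths, contain the
constant function `1` (the empty word) and are closed under pointwise
multiplication: the product of the coordinate iterated integrals of two words
`u, v` is a finite linear combination, with natural number coefficients, of
coordinate iterated integrals of words of length `|u| + |v|`. Hence their
linear span is an algebra of functions on paths containing the constants. -/
theorem signature_coefficients_span_algebra {d : ℕ} (a b : ℝ) (hab : a ≤ b) :
    ((fun γ : ℝ → EuclideanSpace ℝ (Fin d) => sig γ [] a b) = fun _ => 1) ∧
      ∀ u v : List (Fin d), ∃ (W : Finset (List (Fin d))) (c : List (Fin d) → ℕ),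
        (∀ w ∈ W, w.length = u.length + v.length) ∧
        ∀ γ : ℝ → EuclideanSpace ℝ (Fin d), ContDiff ℝ 1 γ →
          sig γ u a b * sig γ v a b = ∑ w ∈ W, (c w : ℝ) * sig γ w a b := by
  refine ⟨by simp only [sig], fun u v => ⟨(wordShuffle u v).toFinset,
    fun w => (wordShuffle u v).count w, fun w hw => ?_, fun γ hγ => ?_⟩⟩
  · exact length_of_mem_wordShuffle u v w (List.mem_toFinset.1 hw)
  · rw [sig_mul_sig hγ, Finset.sum_list_map_count]
    simp only [nsmul_eq_mul]
    refine Finset.sum_congr rfl fun w _ => ?_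
    congr!
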